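/- Let k ≥ 1 be an integer and let π/3 < ε < 2π/3, and set C = 1/(2·sin(π/3 − ε/2)). Then F_2(ε, 2^{k+1}) > √3·(C^k − 1)/(C − 1) − 1. -/

import Mathlib

open Real

noncomputable section

/-- Vertex set of a full Steiner topology on `n` terminals:
`n` terminals and `n - 2` Steiner points. -/
abbrev SteinerVert (n : ℕ) := Fin n ⊕ Fin (n - 2)

/-- Euclidean space `ℝ^d`. -/
abbrev Epc (d : ℕ) := EuclideanSpace ℝ (Fin d)

/-- A full Steiner topology on `n` terminals: a tree on `n` terminals and `n - 2`
Steiner points in which every terminal has degree `1` and every Steiner point has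
degree `3`. -/
structure FullSteinerTopology (n : ℕ) where
  graph : SimpleGraph (SteinerVert n)
  isTree : graph.IsTree
  degTerminal : ∀ t : Fin n, (graph.neighborSet (Sum.inl t)).ncard = 1
  degSteiner : ∀ s : Fin (n - 2), (graph.neighborSet (Sum.inr s)).ncard = 3

open Classical in
/-- The total length of the Steiner tree obtained by realizing the topology `G`
via the placement `pos`, i.e. the sum of the Euclidean lengths of its edges. -/
noncomputable def treeLength {n d : ℕ} (G : FullSteinerTopology n)
    (pos : SteinerVert n → Epc d) : ℝ :=
  (1 / 2) * ∑ u : SteinerVert n, ∑ v : SteinerVert n,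
    if G.graph.Adj u v then dist (pos u) (pos v) else 0

/-- The realization `pos` of the topology `G` is a full `ε`-approximate Steiner tree:
at every Steiner point, every angle spanned by two incident edges lies in
`[2π/3 - ε, 2π/3 + ε]`. -/
def IsApproxSteiner {n d : ℕ} (ε : ℝ) (G : FullSteinerTopology n)
    (pos : SteinerVert n → Epc d) : Prop :=
  ∀ s : Fin (n - 2), ∀ u v : SteinerVert n,
    G.graph.Adj (Sum.inr s) u → G.graph.Adj (Sum.inr s) v → u ≠ v →
      |EuclideanGeometry.angle (pos u) (pos (Sum.inr s)) (pos v) - 2 * π / 3| ≤ ε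

/-- A locally minimum Steiner tree: no degenerate edges, and every angle spanned by
two edges at a common vertex is at least `2π/3`. -/
def IsLocallyMinimumTree {n d : ℕ} (G : FullSteinerTopology n)
    (pos : SteinerVert n → Epc d) : Prop :=
  (∀ u v : SteinerVert n, G.graph.Adj u v → pos u ≠ pos v) ∧
  ∀ x u v : SteinerVert n, G.graph.Adj x u → G.graph.Adj x v → u ≠ v →
    2 * π / 3 ≤ EuclideanGeometry.angle (pos u) (pos x) (pos v)

/-- The length `L(S(T))` of the shortest Steiner tree with the same topology `G` and the
same terminals as the realization `pos` (degenerate edges allowed). -/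
noncomputable def minTreeLength {n d : ℕ} (G : FullSteinerTopology n)
    (pos : SteinerVert n → Epc d) : ℝ :=
  sInf { L : ℝ | ∃ pos' : SteinerVert n → Epc d,
    (∀ t : Fin n, pos' (Sum.inl t) = pos (Sum.inl t)) ∧ L = treeLength G pos' }

/-- `F_d(ε, n)`: the supremum of `L(T)/L(S(T)) - 1` over all full `ε`-approximate
Steiner trees `T` on `n` terminals in `ℝ^d`. -/
noncomputable def steinerF (d : ℕ) (ε : ℝ) (n : ℕ) : ℝ :=
  sSup { r : ℝ | ∃ (G : FullSteinerTopology n) (pos : SteinerVert n → Epc d),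
    IsApproxSteiner ε G pos ∧
    r = treeLength G pos / minTreeLength G pos - 1 }

/-- `G_d(ε, n)`: the supremum of `L(T)/L(S(T)) - 1` over all full `ε`-approximate
Steiner trees `T` on `n` terminals in `ℝ^d` such that the shortest tree `S(T)` with the
same terminals and topology is a (non-degenerate) locally minimum Steiner tree. -/
noncomputable def steinerG (d : ℕ) (ε : ℝ) (n : ℕ) : ℝ :=
  sSup { r : ℝ | ∃ (G : FullSteinerTopology n)
    (pos pos' : SteinerVert n → Epc d),
    IsApproxSteiner ε G pos ∧
    (∀ t : Fin n, pos' (Sum.inl t) = pos (Sum.inl t)) ∧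
    treeLength G pos' = minTreeLength G pos ∧
    IsLocallyMinimumTree G pos' ∧
    r = treeLength G pos / minTreeLength G pos - 1 }


theorem SimpleGraph.IsTree.eq_of_adj_of_dist_lt {V : Type*} {G : SimpleGraph V} (hG : G.IsTree)
    (r : V) {v a b : V} (ha : G.Adj v a) (hb : G.Adj v b)
    (hda : G.dist r a ≤ G.dist r v) (hdb : G.dist r b ≤ G.dist r v) : a = b := by
  have key : ∀ c, G.Adj v c → G.dist r c ≤ G.dist r v →
      ∃ p : G.Walk r v, p.IsPath ∧ p.penultimate = c := by
    intro c hc hdc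
    obtain ⟨p, hp⟩ := (hG.connected r c).exists_walk_length_eq_dist
    refine ⟨p.concat hc.symm, ?_, by simp⟩
    apply SimpleGraph.Walk.isPath_of_length_eq_dist
    rw [SimpleGraph.Walk.length_concat, hp]
    rcases hG.dist_eq_dist_add_one_of_adj r hc with h | h <;> omega
  obtain ⟨p, hp, rfl⟩ := key a ha hda
  obtain ⟨q, hq, rfl⟩ := key b hb hdb
  have := (hG.isAcyclic.subsingleton_path r v).elim ⟨p, hp⟩ ⟨q, hq⟩
  rw [Subtype.mk.injEq] at this
  rw [this]

theorem SimpleGraph.IsTree.exists_mem_adj_unique {V : Type*} {G : SimpleGraph V} (hG : G.IsTree)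
    {U : Finset V} (hU : U.Nonempty) :
    ∃ v ∈ U, ∀ a ∈ U, ∀ b ∈ U, G.Adj v a → G.Adj v b → a = b := by
  have r := hU.choose
  obtain ⟨v, hv, hmax⟩ := U.exists_max_image (G.dist r) hU
  exact ⟨v, hv, fun a ha b hb hva hvb =>
    hG.eq_of_adj_of_dist_lt r hva hvb (hmax a ha) (hmax b hb)⟩

theorem sin_mul_dist_le_dist_of_le_angle {V P : Type*} [NormedAddCommGroup V]
    [InnerProductSpace ℝ V] [MetricSpace P] [NormedAddTorsor V P] {α : ℝ} (hα0 : 0 ≤ α)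
    (hα : α ≤ π / 2) {a s b : P} (h : α ≤ EuclideanGeometry.angle a s b) :
    sin α * dist a s ≤ dist a b := by
  have hcos : cos (EuclideanGeometry.angle a s b) ≤ cos α :=
    cos_le_cos_of_nonneg_of_le_pi hα0 (EuclideanGeometry.angle_le_pi _ _ _) h
  have hlaw := EuclideanGeometry.law_cos a s b
  have hc := cos_nonneg_of_mem_Icc ⟨by linarith [pi_pos], hα⟩
  have hsc := sin_sq_add_cos_sq α
  have hprod : 0 ≤ dist a s * dist b s := by positivity
  have hmul := mul_le_mul_of_nonneg_left hcos hprod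
  apply le_of_sq_le_sq _ dist_nonneg
  nlinarith [sq_nonneg (dist b s - cos α * dist a s)]

theorem dist_le_pow_mul_of_isApproxSteiner {n d : ℕ} {ε : ℝ} (hε1 : π / 6 ≤ ε)
    (hε2 : ε < 2 * π / 3) (G : FullSteinerTopology n) (pos : SteinerVert n → Epc d)
    (hpos : IsApproxSteiner ε G pos) (o : Epc d) (j : ℕ) :
    ∀ (U : Finset (SteinerVert n)) (R : ℝ), 0 ≤ R → U.card ≤ j →
      (∀ t : Fin n, Sum.inl t ∉ U) → (∀ v, v ∉ U → dist (pos v) o ≤ R) →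
      ∀ v, dist (pos v) o ≤ (1 + 2 / sin (2 * π / 3 - ε)) ^ j * R := by
  have hsin : 0 < sin (2 * π / 3 - ε) :=
    sin_pos_of_pos_of_lt_pi (by linarith) (by linarith [pi_pos])
  set K := 1 + 2 / sin (2 * π / 3 - ε) with hK
  have hK1 : 1 ≤ K := by rw [hK]; linarith [div_pos two_pos hsin]
  induction j with
  | zero =>
    intro U R _ hU _ hv v
    simpa using hv v (by simp [Finset.card_eq_zero.mp (Nat.le_zero.mp hU)])
  | succ j ih =>
    intro U R hR hU ht hv v
    rcases U.eq_empty_or_nonempty with rfl | hne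
    · exact (hv v (by simp)).trans (le_mul_of_one_le_left hR (one_le_pow₀ hK1))
    obtain ⟨w, hwU, hw⟩ := G.isTree.exists_mem_adj_unique hne
    rcases w with t | s
    · exact absurd hwU (ht t)
    classical
    obtain ⟨x, y, z, hxy, hxz, hyz, hset⟩ := Set.ncard_eq_three.mp (G.degSteiner s)
    have hadj : ∀ c, G.graph.Adj (Sum.inr s) c ↔ c = x ∨ c = y ∨ c = z := by
      intro c
      have : c ∈ G.graph.neighborSet (Sum.inr s) ↔ c ∈ ({x, y, z} : Set _) := by rw [hset]
      simpa using this
    obtain ⟨a, b, hab, ha, hb, haU, hbU⟩ : ∃ a b, a ≠ b ∧ G.graph.Adj (Sum.inr s) a ∧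
        G.graph.Adj (Sum.inr s) b ∧ a ∉ U ∧ b ∉ U := by
      have hx := (hadj x).2 (by simp)
      have hy := (hadj y).2 (by simp)
      have hz := (hadj z).2 (by simp)
      by_cases hxU : x ∈ U
      · exact ⟨y, z, hyz, hy, hz, fun h => hxy (hw _ hxU _ h hx hy),
          fun h => hxz (hw _ hxU _ h hx hz)⟩
      · by_cases hyU : y ∈ U
        · exact ⟨x, z, hxz, hx, hz, hxU, fun h => hyz (hw _ hyU _ h hy hz)⟩
        · exact ⟨x, y, hxy, hx, hy, hxU, hyU⟩
    have hangle := (abs_le.mp (hpos s a b ha hb hab)).1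
    have hsd := sin_mul_dist_le_dist_of_le_angle (α := 2 * π / 3 - ε) (by linarith)
      (by linarith) (by linarith : _ ≤ EuclideanGeometry.angle (pos a) (pos (Sum.inr s)) (pos b))
    have h2R : dist (pos a) (pos b) ≤ 2 * R := by
      linarith [dist_triangle_right (pos a) (pos b) o, hv a haU, hv b hbU]
    have hsR : dist (pos (Sum.inr s)) o ≤ K * R := by
      have h1 : dist (pos a) (pos (Sum.inr s)) ≤ 2 * R / sin (2 * π / 3 - ε) := by
        rw [le_div_iff₀ hsin]; linarith
      have h2 := dist_triangle_left (pos (Sum.inr s)) o (pos a)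
      calc dist (pos (Sum.inr s)) o ≤ 2 * R / sin (2 * π / 3 - ε) + R := by
            linarith [hv a haU]
        _ = K * R := by rw [hK]; ring
    have := ih (U.erase (Sum.inr s)) (K * R) (by positivity)
      (by rw [Finset.card_erase_of_mem hwU]; omega)
      (fun t h => ht t (Finset.mem_of_mem_erase h)) (by
        intro u hu
        by_cases h : u = Sum.inr s
        · rw [h]; exact hsR
        · exact (hv u fun hu' => hu (Finset.mem_erase.2 ⟨h, hu'⟩)).trans
            (le_mul_of_one_le_left hR hK1)) v
    rwa [pow_succ, mul_assoc]

theorem treeLength_nonneg {n d : ℕ} (G : FullSteinerTopology n) (pos : SteinerVert n → Epc d) :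
    0 ≤ treeLength G pos := by
  unfold treeLength
  refine mul_nonneg (by norm_num) (Finset.sum_nonneg fun u _ => Finset.sum_nonneg fun v _ => ?_)
  split_ifs
  exacts [dist_nonneg, le_rfl]

theorem dist_le_two_mul_treeLength_of_adj {n d : ℕ} (G : FullSteinerTopology n)
    (pos : SteinerVert n → Epc d) {u v : SteinerVert n} (h : G.graph.Adj u v) :
    dist (pos u) (pos v) ≤ 2 * treeLength G pos := by
  classical
  have h0 : ∀ a b, 0 ≤ if G.graph.Adj a b then dist (pos a) (pos b) else 0 := by
    intro a b
    split_ifs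
    exacts [dist_nonneg, le_rfl]
  have h1 := Finset.single_le_sum (f := fun b => if G.graph.Adj u b then dist (pos u) (pos b) else 0)
    (fun b _ => h0 u b) (Finset.mem_univ v)
  have h2 := Finset.single_le_sum
    (f := fun a => ∑ b, if G.graph.Adj a b then dist (pos a) (pos b) else 0)
    (fun a _ => Finset.sum_nonneg fun b _ => h0 a b) (Finset.mem_univ u)
  simp only [h, if_true] at h1
  unfold treeLength
  linarith [h1.trans h2]

theorem dist_le_mul_treeLength {n d : ℕ} (G : FullSteinerTopology n)
    (pos : SteinerVert n → Epc d) (u v : SteinerVert n) :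
    dist (pos u) (pos v) ≤ 2 * Fintype.card (SteinerVert n) * treeLength G pos := by
  classical
  have hwalk : ∀ {a b : SteinerVert n} (p : G.graph.Walk a b),
      dist (pos a) (pos b) ≤ p.length * (2 * treeLength G pos) := by
    intro a b p
    induction p with
    | nil => simp
    | cons h p ih =>
      rw [SimpleGraph.Walk.length_cons]
      push_cast
      linarith [dist_triangle (pos _) (pos _) (pos _) |>.trans
        (add_le_add (dist_le_two_mul_treeLength_of_adj G pos h) ih)]
  obtain ⟨p, hp⟩ := (G.isTree.connected u v).exists_isPath
  have hlen : (p.length : ℝ) ≤ Fintype.card (SteinerVert n) := by exact_mod_cast hp.length_lt.le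
  have := treeLength_nonneg G pos
  calc dist (pos u) (pos v) ≤ p.length * (2 * treeLength G pos) := hwalk p
    _ ≤ Fintype.card (SteinerVert n) * (2 * treeLength G pos) := by gcongr
    _ = _ := by ring

theorem dist_terminals_le_mul_minTreeLength {n d : ℕ} (G : FullSteinerTopology n)
    (pos : SteinerVert n → Epc d) (s t : Fin n) :
    dist (pos (Sum.inl s)) (pos (Sum.inl t)) ≤
      2 * Fintype.card (SteinerVert n) * minTreeLength G pos := by
  have hcard : (0 : ℝ) < 2 * Fintype.card (SteinerVert n) := by
    have : 0 < Fintype.card (SteinerVert n) := Fintype.card_pos_iff.2 ⟨Sum.inl s⟩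
    positivity
  rw [← div_le_iff₀' hcard]
  refine le_csInf ⟨_, pos, fun _ => rfl, rfl⟩ ?_
  rintro _ ⟨pos', hpos', rfl⟩
  rw [div_le_iff₀' hcard, ← hpos' s, ← hpos' t]
  exact dist_le_mul_treeLength G pos' _ _

theorem minTreeLength_le {n d : ℕ} (G : FullSteinerTopology n)
    (pos pos' : SteinerVert n → Epc d) (h : ∀ t : Fin n, pos' (Sum.inl t) = pos (Sum.inl t)) :
    minTreeLength G pos ≤ treeLength G pos' :=
  csInf_le ⟨0, by rintro _ ⟨q, -, rfl⟩; exact treeLength_nonneg G q⟩ ⟨pos', h, rfl⟩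

theorem minTreeLength_nonneg {n d : ℕ} (G : FullSteinerTopology n)
    (pos : SteinerVert n → Epc d) : 0 ≤ minTreeLength G pos :=
  le_csInf ⟨_, pos, fun _ => rfl, rfl⟩ (by rintro _ ⟨q, -, rfl⟩; exact treeLength_nonneg G q)

theorem bddAbove_approxSteiner_ratio {d : ℕ} {ε : ℝ} {n : ℕ} (hn : 0 < n) (hε1 : π / 6 ≤ ε)
    (hε2 : ε < 2 * π / 3) :
    BddAbove { r : ℝ | ∃ (G : FullSteinerTopology n) (pos : SteinerVert n → Epc d),
      IsApproxSteiner ε G pos ∧ r = treeLength G pos / minTreeLength G pos - 1 } := by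
  classical
  have hsin : 0 < sin (2 * π / 3 - ε) :=
    sin_pos_of_pos_of_lt_pi (by linarith) (by linarith [pi_pos])
  set K := (1 + 2 / sin (2 * π / 3 - ε)) ^ (n - 2) with hK
  have hK0 : 0 ≤ K := by positivity
  set N := (Fintype.card (SteinerVert n) : ℝ) with hN
  have hN0 : 0 ≤ N := by positivity
  refine ⟨N * (N * (2 * (K * (2 * N)))), ?_⟩
  rintro _ ⟨G, pos, hpos, rfl⟩
  set o := pos (Sum.inl ⟨0, hn⟩) with ho
  set M := minTreeLength G pos with hM
  have hM0 : 0 ≤ M := minTreeLength_nonneg G pos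
  have hball : ∀ v, dist (pos v) o ≤ K * (2 * N * M) := by
    refine dist_le_pow_mul_of_isApproxSteiner hε1 hε2 G pos hpos o (n - 2)
      (Finset.univ.image Sum.inr) _ (by positivity) ?_ (by simp) ?_
    · exact Finset.card_image_le.trans (by simp)
    · rintro (t | s) hv
      · exact dist_terminals_le_mul_minTreeLength G pos t ⟨0, hn⟩
      · simp at hv
  have hlen : treeLength G pos ≤ N * (N * (2 * (K * (2 * N)))) * M := by
    have hb : ∀ u v, (if G.graph.Adj u v then dist (pos u) (pos v) else 0) ≤
        2 * (K * (2 * N * M)) := by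
      intro u v
      split_ifs
      · linarith [dist_triangle_right (pos u) (pos v) o, hball u, hball v]
      · positivity
    have hsum : ∑ u : SteinerVert n, ∑ v : SteinerVert n,
        (if G.graph.Adj u v then dist (pos u) (pos v) else 0) ≤
        N * (N * (2 * (K * (2 * N * M)))) := by
      calc _ ≤ ∑ _u : SteinerVert n, ∑ _v : SteinerVert n, 2 * (K * (2 * N * M)) :=
            Finset.sum_le_sum fun u _ => Finset.sum_le_sum fun v _ => hb u v
        _ = _ := by simp [hN]
    have := treeLength_nonneg G pos
    unfold treeLength at this ⊢
    calc _ ≤ N * (N * (2 * (K * (2 * N * M)))) := by linarith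
      _ = _ := by ring
  have := div_le_of_le_mul₀ hM0 (by positivity) hlen
  linarith

/-- Adjacency of the caterpillar: the Steiner points form a path, and terminal `t` hangs
off the Steiner point `t - 1`, clamped to the path. -/
def caterpillarAdj (n : ℕ) : SteinerVert n → SteinerVert n → Prop
  | Sum.inl _, Sum.inl _ => False
  | Sum.inl t, Sum.inr s => s.val = min (t.val - 1) (n - 3)
  | Sum.inr s, Sum.inl t => s.val = min (t.val - 1) (n - 3)
  | Sum.inr a, Sum.inr b => a.val + 1 = b.val ∨ b.val + 1 = a.val

/-- The caterpillar graph on `n` terminals and `n - 2` Steiner points. -/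
def caterpillarGraph (n : ℕ) : SimpleGraph (SteinerVert n) where
  Adj := caterpillarAdj n
  symm := ⟨by
    rintro (a | a) (b | b) h
    · exact h
    · exact h
    · exact h
    · exact Or.symm h⟩
  loopless := ⟨by
    rintro (a | a) h
    · exact h
    · rcases h with h | h <;> omega⟩

theorem caterpillarGraph_neighborSet_inl {n : ℕ} (hn : 4 ≤ n) (t : Fin n) :
    (caterpillarGraph n).neighborSet (Sum.inl t) =
      {Sum.inr ⟨min (t.val - 1) (n - 3), by omega⟩} := by
  ext (u | u)
  · simp [caterpillarGraph, caterpillarAdj]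
  · simp [caterpillarGraph, caterpillarAdj, Fin.ext_iff]

/-- The vertex preceding the Steiner point `s` on the spine of the caterpillar. -/
def caterpillarPrev {n : ℕ} (s : Fin (n - 2)) : SteinerVert n :=
  if s.val = 0 then Sum.inl ⟨0, by have := s.isLt; omega⟩ else Sum.inr ⟨s.val - 1, by omega⟩

/-- The vertex following the Steiner point `s` on the spine of the caterpillar. -/
def caterpillarNext {n : ℕ} (s : Fin (n - 2)) : SteinerVert n :=
  if h : s.val + 3 = n then Sum.inl ⟨n - 1, by omega⟩ else Sum.inr ⟨s.val + 1, by omega⟩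

theorem caterpillarGraph_neighborSet_inr {n : ℕ} (s : Fin (n - 2)) :
    (caterpillarGraph n).neighborSet (Sum.inr s) =
      {Sum.inl ⟨s.val + 1, by omega⟩, caterpillarPrev s, caterpillarNext s} := by
  have hs := s.isLt
  ext (u | u)
  · have hu := u.isLt
    simp only [SimpleGraph.mem_neighborSet, caterpillarGraph, caterpillarAdj, caterpillarPrev,
      caterpillarNext, Set.mem_insert_iff, Set.mem_singleton_iff]
    split_ifs <;> simp [Fin.ext_iff] <;> omega
  · have hu := u.isLt
    simp only [SimpleGraph.mem_neighborSet, caterpillarGraph, caterpillarAdj, caterpillarPrev,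
      caterpillarNext, Set.mem_insert_iff, Set.mem_singleton_iff]
    split_ifs <;> simp [Fin.ext_iff] <;> omega

theorem caterpillarGraph_ncard_inl {n : ℕ} (hn : 4 ≤ n) (t : Fin n) :
    ((caterpillarGraph n).neighborSet (Sum.inl t)).ncard = 1 := by
  rw [caterpillarGraph_neighborSet_inl hn, Set.ncard_singleton]

theorem caterpillarGraph_ncard_inr {n : ℕ} (hn : 4 ≤ n) (s : Fin (n - 2)) :
    ((caterpillarGraph n).neighborSet (Sum.inr s)).ncard = 3 := by
  rw [caterpillarGraph_neighborSet_inr, Set.ncard_eq_three]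
  have hs := s.isLt
  refine ⟨_, _, _, ?_, ?_, ?_, rfl⟩
  · unfold caterpillarPrev
    split_ifs <;> simp
  · unfold caterpillarNext
    split_ifs <;> simp
    omega
  · unfold caterpillarPrev caterpillarNext
    split_ifs <;> simp
    omega

theorem caterpillarGraph_connected {n : ℕ} (hn : 4 ≤ n) : (caterpillarGraph n).Connected := by
  have hspine : ∀ (i : ℕ) (hi : i < n - 2),
      (caterpillarGraph n).Reachable (Sum.inr ⟨0, by omega⟩) (Sum.inr ⟨i, hi⟩) := by
    intro i
    induction i with
    | zero => exact fun _ => SimpleGraph.Reachable.refl _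
    | succ i ih =>
      intro hi
      have hadj : (caterpillarGraph n).Adj (Sum.inr ⟨i, by omega⟩) (Sum.inr ⟨i + 1, hi⟩) :=
        Or.inl rfl
      exact (ih (by omega)).trans hadj.reachable
  have hall : ∀ v, (caterpillarGraph n).Reachable (Sum.inr ⟨0, by omega⟩) v := by
    rintro (t | s)
    · have hadj : (caterpillarGraph n).Adj (Sum.inr ⟨min (t.val - 1) (n - 3), by omega⟩)
        (Sum.inl t) := rfl
      exact (hspine _ _).trans hadj.reachable
    · exact hspine s s.isLt
  exact { preconnected := fun u v => (hall u).symm.trans (hall v)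
          nonempty := ⟨Sum.inr ⟨0, by omega⟩⟩ }

theorem caterpillarGraph_isTree {n : ℕ} (hn : 4 ≤ n) : (caterpillarGraph n).IsTree := by
  classical
  rw [SimpleGraph.isTree_iff_connected_and_card]
  refine ⟨caterpillarGraph_connected hn, ?_⟩
  have hdeg : ∀ v, (caterpillarGraph n).degree v =
      ((caterpillarGraph n).neighborSet v).ncard := by
    intro v
    rw [Set.ncard_eq_toFinset_card', SimpleGraph.degree, SimpleGraph.neighborFinset]
  have hsum := (caterpillarGraph n).sum_degrees_eq_twice_card_edges
  simp only [hdeg, Fintype.sum_sum_type, caterpillarGraph_ncard_inl hn,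
    caterpillarGraph_ncard_inr hn, Finset.sum_const, Finset.card_univ, Fintype.card_fin,
    smul_eq_mul] at hsum
  rw [Nat.card_eq_fintype_card, Nat.card_eq_fintype_card, ← SimpleGraph.edgeFinset_card]
  simp only [Fintype.card_sum, Fintype.card_fin]
  omega

/-- The caterpillar as a full Steiner topology. -/
def caterpillar {n : ℕ} (hn : 4 ≤ n) : FullSteinerTopology n where
  graph := caterpillarGraph n
  isTree := caterpillarGraph_isTree hn
  degTerminal := caterpillarGraph_ncard_inl hn
  degSteiner := caterpillarGraph_ncard_inr hn

open Classical in
theorem treeLength_caterpillar {n d : ℕ} (hn : 4 ≤ n) (pos : SteinerVert n → Epc d) :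
    treeLength (caterpillar hn) pos =
      ∑ t : Fin n, dist (pos (Sum.inl t)) (pos (Sum.inr ⟨min (t.val - 1) (n - 3), by omega⟩)) +
      (1 / 2) * ∑ a : Fin (n - 2), ∑ b : Fin (n - 2),
        if (caterpillar hn).graph.Adj (Sum.inr a) (Sum.inr b) then
          dist (pos (Sum.inr a)) (pos (Sum.inr b)) else 0 := by
  have hadj : ∀ t s, (caterpillar hn).graph.Adj (Sum.inl t) (Sum.inr s) ↔
      s.val = min (t.val - 1) (n - 3) := fun _ _ => Iff.rfl
  have hfoot : ∀ t : Fin n, (∑ s : Fin (n - 2),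
      if (caterpillar hn).graph.Adj (Sum.inl t) (Sum.inr s) then
        dist (pos (Sum.inl t)) (pos (Sum.inr s)) else 0) =
      dist (pos (Sum.inl t)) (pos (Sum.inr ⟨min (t.val - 1) (n - 3), by omega⟩)) := by
    intro t
    rw [Finset.sum_eq_single ⟨min (t.val - 1) (n - 3), by omega⟩]
    · simp [hadj]
    · intro s _ hs
      rw [if_neg fun h => hs (Fin.ext ((hadj t s).1 h))]
    · simp
  have hswap : (∑ s : Fin (n - 2), ∑ t : Fin n,
      if (caterpillar hn).graph.Adj (Sum.inr s) (Sum.inl t) then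
        dist (pos (Sum.inr s)) (pos (Sum.inl t)) else 0) =
      ∑ t : Fin n, dist (pos (Sum.inl t))
        (pos (Sum.inr ⟨min (t.val - 1) (n - 3), by omega⟩)) := by
    rw [Finset.sum_comm]
    simp only [dist_comm (pos (Sum.inr _)) (pos (Sum.inl _)),
      SimpleGraph.adj_comm _ (Sum.inr _) (Sum.inl _), hfoot]
  have hll : ∀ t t', ¬(caterpillar hn).graph.Adj (Sum.inl t) (Sum.inl t') := fun _ _ h => h
  unfold treeLength
  simp only [Fintype.sum_sum_type, hll, if_false, Finset.sum_const_zero, zero_add,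
    Finset.sum_add_distrib, hfoot, hswap]
  ring

theorem le_angle_of_inner_le {V : Type*} [NormedAddCommGroup V] [InnerProductSpace ℝ V] {α : ℝ}
    (hα0 : 0 ≤ α) (hα : α ≤ π / 2) {x y : V} (h : inner ℝ x y ≤ cos α * (‖x‖ * ‖y‖)) :
    α ≤ InnerProductGeometry.angle x y := by
  have hc := cos_nonneg_of_mem_Icc ⟨by linarith [pi_pos], hα⟩
  rw [← arccos_cos hα0 (by linarith [pi_pos])]
  exact arccos_le_arccos (div_le_of_le_mul₀ (by positivity) hc h)

theorem le_angle_spiral {α C : ℝ} {z : ℂ} (hα0 : 0 ≤ α) (hα : α ≤ π / 3) (hC : 1 ≤ C)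
    (hcos : 2 * C ^ 2 * cos α = 2 * C ^ 2 - 1) (hre : z.re = 1 / 2) (hz : ‖z‖ = C)
    (q r : ℕ) (hr : r = q + 1 ∨ r = q + 2) :
    α ≤ InnerProductGeometry.angle (0 - z ^ (q + 1)) (z ^ q - z ^ (q + 1)) ∧
    α ≤ InnerProductGeometry.angle (0 - z ^ (q + 1)) (z ^ r - z ^ (q + 1)) ∧
    α ≤ InnerProductGeometry.angle (z ^ q - z ^ (q + 1)) (z ^ r - z ^ (q + 1)) := by
  have hhalf : 1 / 2 ≤ cos α := by
    rw [← cos_pi_div_three]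
    exact cos_le_cos_of_nonneg_of_le_pi hα0 (by linarith [pi_pos]) hα
  have hz0 : z ^ q ≠ 0 := pow_ne_zero _ fun h => by simp [h] at hre
  have hα2 : α ≤ π / 2 := by linarith [pi_pos]
  have hsq : z.im * z.im = C ^ 2 - 1 / 4 := by
    have := Complex.sq_norm z
    rw [hz, Complex.normSq_apply, hre] at this
    linarith
  have hb : (1 - z) = (starRingEnd ℂ) z := by
    apply Complex.ext <;> simp [hre]; norm_num
  have hc : z ^ 2 - z = ((-C ^ 2 : ℝ) : ℂ) := by
    apply Complex.ext
    · simp only [pow_two, Complex.sub_re, Complex.mul_re, Complex.ofReal_re, hre, hsq]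
      ring
    · simp only [pow_two, Complex.sub_im, Complex.mul_im, Complex.ofReal_im, hre]
      ring
  have e0 : 0 - z ^ (q + 1) = z ^ q * (-z) := by ring
  have e1 : z ^ q - z ^ (q + 1) = z ^ q * (1 - z) := by ring
  have e2 : z ^ (q + 2) - z ^ (q + 1) = z ^ q * (z ^ 2 - z) := by ring
  have hnb : ‖1 - z‖ = C := by rw [hb, Complex.norm_conj, hz]
  have hnc : ‖z ^ 2 - z‖ = C ^ 2 := by
    rw [hc, Complex.norm_real, norm_neg, Real.norm_of_nonneg (by positivity)]
  refine ⟨?_, ?_⟩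
  · rw [e0, e1, Complex.angle_mul_left hz0]
    apply le_angle_of_inner_le hα0 hα2
    rw [hnb, norm_neg, hz, hb, Complex.inner]
    simp only [map_neg, Complex.mul_re, Complex.neg_re, Complex.neg_im, Complex.conj_re,
      Complex.conj_im, hre]
    nlinarith
  · rcases hr with rfl | rfl
    · simp only [sub_self, InnerProductGeometry.angle_zero_right]
      exact ⟨hα2, hα2⟩
    · rw [e0, e1, e2, Complex.angle_mul_left hz0, Complex.angle_mul_left hz0]
      constructor
      · apply le_angle_of_inner_le hα0 hα2
        rw [hnc, norm_neg, hz, hc, Complex.inner]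
        simp only [map_neg, Complex.mul_re, Complex.neg_re, Complex.neg_im, Complex.conj_re,
          Complex.conj_im, hre, Complex.ofReal_re, Complex.ofReal_im]
        have : 1 / 2 ≤ cos α * C := by nlinarith
        nlinarith [sq_nonneg C]
      · apply le_angle_of_inner_le hα0 hα2
        rw [hnb, hnc, hb, hc, Complex.inner]
        simp only [Complex.conj_conj, Complex.mul_re, hre, Complex.ofReal_re, Complex.ofReal_im]
        have : 0 ≤ cos α * (C * C ^ 2) := by positivity
        nlinarith [sq_nonneg C]

/-- Two copies of a spiral of powers of `z` around the origin, laid out on a caterpillar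
so that they meet in the middle of the spine. -/
def spiral (z : ℂ) (n : ℕ) : SteinerVert n → ℂ
  | Sum.inl t => if t.val = 0 ∨ t.val + 1 = n then 1 else 0
  | Sum.inr s => z ^ min (s.val + 1) (n - 2 - s.val)

theorem exists_spiral_neighbors (z : ℂ) {n : ℕ} (hn : Even n) (s : Fin (n - 2)) :
    ∃ q r : ℕ, (r = q + 1 ∨ r = q + 2) ∧ spiral z n (Sum.inr s) = z ^ (q + 1) ∧
      spiral z n (Sum.inl ⟨s.val + 1, by omega⟩) = 0 ∧
      ((spiral z n (caterpillarPrev s) = z ^ q ∧ spiral z n (caterpillarNext s) = z ^ r) ∨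
        (spiral z n (caterpillarPrev s) = z ^ r ∧ spiral z n (caterpillarNext s) = z ^ q)) := by
  obtain ⟨m, rfl⟩ := hn
  obtain ⟨s, hs⟩ := s
  have hterm : spiral z (m + m) (Sum.inl ⟨s + 1, by omega⟩) = 0 :=
    if_neg (by simp only; omega)
  have hprev : spiral z (m + m) (caterpillarPrev ⟨s, hs⟩) = z ^ min s (m + m - 1 - s) := by
    unfold caterpillarPrev
    split_ifs with h
    · simp only at h
      simp [spiral, h]
    · simp only at h
      simp only [spiral]
      congr 1
      omega
  have hnext : spiral z (m + m) (caterpillarNext ⟨s, hs⟩) =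
      z ^ min (s + 2) (m + m - 3 - s) := by
    unfold caterpillarNext
    split_ifs with h
    · simp only at h
      have h1 : m + m - 3 - s = 0 := by omega
      have h2 : m + m - 1 + 1 = m + m := by omega
      simp [spiral, h1, h2]
    · simp only at h
      simp only [spiral]
      congr 1
      omega
  have hsp : spiral z (m + m) (Sum.inr ⟨s, hs⟩) = z ^ min (s + 1) (m + m - 2 - s) := rfl
  rcases le_or_gt (s + 1) (m - 1) with h | h
  · refine ⟨s, min (s + 2) (m + m - 3 - s), by omega, ?_, hterm, Or.inl ⟨?_, hnext⟩⟩
    · rw [hsp]; congr 1; omega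
    · rw [hprev]; congr 1; omega
  · refine ⟨m + m - 3 - s, min s (m + m - 1 - s), by omega, ?_, hterm, Or.inr ⟨hprev, ?_⟩⟩
    · rw [hsp]; congr 1; omega
    · rw [hnext]; congr 1; omega

theorem le_angle_spiral_of_adj {α C : ℝ} {z : ℂ} (hα0 : 0 ≤ α) (hα : α ≤ π / 3) (hC : 1 ≤ C)
    (hcos : 2 * C ^ 2 * cos α = 2 * C ^ 2 - 1) (hre : z.re = 1 / 2) (hz : ‖z‖ = C)
    {n : ℕ} (hn4 : 4 ≤ n) (hn : Even n) (s : Fin (n - 2)) {u v : SteinerVert n}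
    (hu : (caterpillar hn4).graph.Adj (Sum.inr s) u)
    (hv : (caterpillar hn4).graph.Adj (Sum.inr s) v) (huv : u ≠ v) :
    α ≤ EuclideanGeometry.angle (spiral z n u) (spiral z n (Sum.inr s)) (spiral z n v) := by
  obtain ⟨q, r, hr, hs, h0, hpn⟩ := exists_spiral_neighbors z hn s
  obtain ⟨h1, h2, h3⟩ := le_angle_spiral hα0 hα hC hcos hre hz q r hr
  have hmem : ∀ w, (caterpillar hn4).graph.Adj (Sum.inr s) w →
      w = Sum.inl ⟨s.val + 1, by omega⟩ ∨ w = caterpillarPrev s ∨ w = caterpillarNext s := by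
    intro w hw
    have : w ∈ (caterpillarGraph n).neighborSet (Sum.inr s) := hw
    simpa [caterpillarGraph_neighborSet_inr] using this
  simp only [EuclideanGeometry.angle, vsub_eq_sub, hs]
  have h1' := h1
  have h2' := h2
  have h3' := h3
  rw [InnerProductGeometry.angle_comm] at h1' h2' h3'
  rcases hmem u hu with rfl | rfl | rfl <;> rcases hmem v hv with rfl | rfl | rfl <;>
    first
    | exact absurd rfl huv
    | (rcases hpn with ⟨hp, hx⟩ | ⟨hp, hx⟩ <;> simp only [h0, hp, hx] <;> assumption)

theorem isApproxSteiner_spiral {ε C : ℝ} {z : ℂ} (hε1 : π / 3 < ε) (hε2 : ε < 2 * π / 3)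
    (hC : 1 ≤ C) (hcos : 2 * C ^ 2 * cos (2 * π / 3 - ε) = 2 * C ^ 2 - 1) (hre : z.re = 1 / 2)
    (hz : ‖z‖ = C) {n : ℕ} (hn4 : 4 ≤ n) (hn : Even n) :
    IsApproxSteiner ε (caterpillar hn4)
      (fun v => Complex.orthonormalBasisOneI.repr (spiral z n v)) := by
  intro s u v hu hv huv
  have hangle := le_angle_spiral_of_adj (by linarith) (by linarith) hC hcos hre hz hn4 hn s
    hu hv huv
  have hmap : EuclideanGeometry.angle (Complex.orthonormalBasisOneI.repr (spiral z n u))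
      (Complex.orthonormalBasisOneI.repr (spiral z n (Sum.inr s)))
      (Complex.orthonormalBasisOneI.repr (spiral z n v)) =
      EuclideanGeometry.angle (spiral z n u) (spiral z n (Sum.inr s)) (spiral z n v) := by
    simp only [EuclideanGeometry.angle, vsub_eq_sub, ← map_sub]
    exact LinearIsometry.angle_map Complex.orthonormalBasisOneI.repr.toLinearIsometry _ _
  rw [hmap, abs_le]
  constructor
  · linarith
  · linarith [EuclideanGeometry.angle_le_pi (spiral z n u) (spiral z n (Sum.inr s))
      (spiral z n v)]

theorem sum_range_pow_min_reflect (C : ℝ) (m : ℕ) :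
    ∑ i ∈ Finset.range (m + m), C ^ min i (m + m - 1 - i) = 2 * ∑ i ∈ Finset.range m, C ^ i := by
  rw [Finset.sum_range_add, two_mul, ← Finset.sum_range_reflect (fun i => C ^ i) m]
  nth_rewrite 1 [← Finset.sum_range_reflect]
  congr 1 <;> refine Finset.sum_congr rfl fun i hi => ?_ <;>
    rw [Finset.mem_range] at hi <;> congr 1 <;> omega

theorem le_treeLength_spiral {C : ℝ} {z : ℂ} (hC : 1 ≤ C) (hre : z.re = 1 / 2) (hz : ‖z‖ = C)
    {n m : ℕ} (hn4 : 4 ≤ n) (hnm : n = m + m) :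
    2 * ∑ i ∈ Finset.range m, C ^ i ≤ treeLength (caterpillar hn4)
      (fun v => Complex.orthonormalBasisOneI.repr (spiral z n v)) := by
  classical
  have hz1 : ‖1 - z‖ = C := by
    have hb : 1 - z = (starRingEnd ℂ) z := by
      apply Complex.ext <;> simp [hre]; norm_num
    rw [hb, Complex.norm_conj, hz]
  rw [treeLength_caterpillar, ← sum_range_pow_min_reflect, ← hnm,
    ← Fin.sum_univ_eq_sum_range (fun i => C ^ min i (n - 1 - i))]
  have hspine : 0 ≤ (1 / 2 : ℝ) * ∑ a : Fin (n - 2), ∑ b : Fin (n - 2),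
      if (caterpillar hn4).graph.Adj (Sum.inr a) (Sum.inr b) then
        dist (Complex.orthonormalBasisOneI.repr (spiral z n (Sum.inr a)))
          (Complex.orthonormalBasisOneI.repr (spiral z n (Sum.inr b))) else 0 := by
    refine mul_nonneg (by norm_num) (Finset.sum_nonneg fun a _ => Finset.sum_nonneg fun b _ => ?_)
    split_ifs
    exacts [dist_nonneg, le_rfl]
  refine le_add_of_le_of_nonneg (Finset.sum_le_sum fun t _ => ?_) hspine
  have ht := t.isLt
  simp only [LinearIsometryEquiv.dist_map]
  simp only [spiral, dist_eq_norm]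
  split_ifs with h
  · have e1 : min (min (t.val - 1) (n - 3) + 1) (n - 2 - min (t.val - 1) (n - 3)) = 1 := by omega
    have e2 : min t.val (n - 1 - t.val) = 0 := by omega
    rw [e1, e2, pow_one, pow_zero, hz1]
    exact hC
  · rw [zero_sub, norm_neg, norm_pow, hz]
    apply le_of_eq
    congr 1
    omega

theorem minTreeLength_spiral_le (z : ℂ) {n : ℕ} (hn4 : 4 ≤ n) :
    minTreeLength (caterpillar hn4)
      (fun v => Complex.orthonormalBasisOneI.repr (spiral z n v)) ≤ 2 := by
  classical
  refine (minTreeLength_le _ _ (Sum.elim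
    (fun t => Complex.orthonormalBasisOneI.repr (spiral z n (Sum.inl t))) (fun _ => 0))
    fun _ => rfl).trans ?_
  rw [treeLength_caterpillar]
  simp only [Sum.elim_inl, Sum.elim_inr, dist_self, ite_self, Finset.sum_const_zero, mul_zero,
    add_zero, dist_zero_right, LinearIsometryEquiv.norm_map]
  calc ∑ t : Fin n, ‖spiral z n (Sum.inl t)‖
      ≤ ∑ t : Fin n, ((if t = ⟨0, by omega⟩ then 1 else 0) +
          (if t = ⟨n - 1, by omega⟩ then 1 else 0) : ℝ) := by
        refine Finset.sum_le_sum fun t _ => ?_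
        simp only [spiral, Fin.ext_iff]
        split_ifs <;> first | omega | norm_num
    _ = 2 := by
        rw [Finset.sum_add_distrib]
        simp
        norm_num

theorem minTreeLength_spiral_pos (z : ℂ) {n : ℕ} (hn4 : 4 ≤ n) :
    0 < minTreeLength (caterpillar hn4)
      (fun v => Complex.orthonormalBasisOneI.repr (spiral z n v)) := by
  have h := dist_terminals_le_mul_minTreeLength (caterpillar hn4)
    (fun v => Complex.orthonormalBasisOneI.repr (spiral z n v)) ⟨0, by omega⟩ ⟨1, by omega⟩
  have h1 : 1 + 1 ≠ n := by omega
  simp only [LinearIsometryEquiv.dist_map, spiral, h1] at h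
  norm_num at h
  refine pos_of_mul_pos_right (lt_of_lt_of_le one_pos h) (by positivity)

theorem sqrt_three_mul_geom_sum_lt {C : ℝ} (hC : 1 ≤ C) {k : ℕ} (hk : 1 ≤ k) :
    √3 * ∑ i ∈ Finset.range k, C ^ i < ∑ i ∈ Finset.range (2 ^ k), C ^ i := by
  have hk2 : k + k ≤ 2 ^ k := by
    induction k, hk using Nat.le_induction with
    | base => norm_num
    | succ k hk ih => rw [pow_succ]; omega
  have hpos : 0 < ∑ i ∈ Finset.range k, C ^ i :=
    Finset.sum_pos (fun i _ => by positivity) (Finset.nonempty_range_iff.2 (by omega))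
  have hsqrt : √3 < 2 := by
    rw [sqrt_lt' (by norm_num)]
    norm_num
  calc √3 * ∑ i ∈ Finset.range k, C ^ i < 2 * ∑ i ∈ Finset.range k, C ^ i := by gcongr
    _ = ∑ i ∈ Finset.range k, C ^ i + ∑ i ∈ Finset.range k, C ^ i := two_mul _
    _ ≤ ∑ i ∈ Finset.range k, C ^ i + ∑ i ∈ Finset.range k, C ^ (k + i) := by
        gcongr
        omega
    _ = ∑ i ∈ Finset.range (k + k), C ^ i := (Finset.sum_range_add _ _ _).symm
    _ ≤ ∑ i ∈ Finset.range (2 ^ k), C ^ i :=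
        Finset.sum_le_sum_of_subset_of_nonneg (Finset.range_mono hk2)
          fun i _ _ => by positivity

/-- For `k ≥ 1`, `π/3 < ε < 2π/3` and `C = 1/(2·sin(π/3 - ε/2))`,
`F₂(ε, 2^(k+1)) > √3·(C^k - 1)/(C - 1) - 1`. -/
theorem steinerF_large_eps_lower_bound (k : ℕ) (hk : 1 ≤ k)
    (ε : ℝ) (hε1 : π / 3 < ε) (hε2 : ε < 2 * π / 3)
    (C : ℝ) (hC : C = 1 / (2 * Real.sin (π / 3 - ε / 2))) :
    steinerF 2 ε (2 ^ (k + 1)) > Real.sqrt 3 * (C ^ k - 1) / (C - 1) - 1 := by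
  have hn4 : 4 ≤ 2 ^ (k + 1) := by
    calc 4 = 2 ^ (1 + 1) := by norm_num
      _ ≤ 2 ^ (k + 1) := Nat.pow_le_pow_right (by norm_num) (by omega)
  have hnm : 2 ^ (k + 1) = 2 ^ k + 2 ^ k := by rw [pow_succ, mul_two]
  have hsin : 0 < sin (π / 3 - ε / 2) :=
    sin_pos_of_pos_of_lt_pi (by linarith) (by linarith [pi_pos])
  have hsin2 : sin (π / 3 - ε / 2) < 1 / 2 := by
    rw [← sin_pi_div_six]
    exact sin_lt_sin_of_lt_of_le_pi_div_two (by linarith) (by linarith [pi_pos]) (by linarith)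
  have hC1 : 1 < C := by
    rw [hC, lt_div_iff₀ (by positivity)]
    linarith
  have hcos : 2 * C ^ 2 * cos (2 * π / 3 - ε) = 2 * C ^ 2 - 1 := by
    have h1 : 2 * π / 3 - ε = 2 * (π / 3 - ε / 2) := by ring
    have h2 : C * (2 * sin (π / 3 - ε / 2)) = 1 := by
      rw [hC, one_div_mul_cancel (by positivity)]
    rw [h1, cos_two_mul, cos_sq']
    linear_combination (-C * (2 * sin (π / 3 - ε / 2)) - 1) * h2
  obtain ⟨z, hre, hz⟩ : ∃ z : ℂ, z.re = 1 / 2 ∧ ‖z‖ = C := by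
    refine ⟨⟨1 / 2, √(C ^ 2 - 1 / 4)⟩, rfl, ?_⟩
    rw [← sq_eq_sq₀ (norm_nonneg _) (by linarith), Complex.sq_norm, Complex.normSq_mk,
      mul_self_sqrt (by nlinarith)]
    ring
  set pos : SteinerVert (2 ^ (k + 1)) → Epc 2 :=
    fun v => Complex.orthonormalBasisOneI.repr (spiral z _ v) with hpos
  have hratio : treeLength (caterpillar hn4) pos / minTreeLength (caterpillar hn4) pos - 1 ≤
      steinerF 2 ε (2 ^ (k + 1)) :=
    le_csSup (bddAbove_approxSteiner_ratio (by positivity) (by linarith [pi_pos]) hε2)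
      ⟨caterpillar hn4, pos, isApproxSteiner_spiral hε1 hε2 hC1.le hcos hre hz hn4
        ⟨_, hnm⟩, rfl⟩
  have hlen : ∑ i ∈ Finset.range (2 ^ k), C ^ i ≤
      treeLength (caterpillar hn4) pos / minTreeLength (caterpillar hn4) pos := by
    rw [le_div_iff₀ (minTreeLength_spiral_pos z hn4)]
    refine le_trans ?_ (le_treeLength_spiral hC1.le hre hz hn4 hnm)
    rw [mul_comm]
    gcongr
    exact minTreeLength_spiral_le z hn4
  have hgeom := sqrt_three_mul_geom_sum_lt hC1.le hk
  rw [geom_sum_eq hC1.ne' k, ← mul_div_assoc] at hgeom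
  linarith

end
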